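/- Let (X_k)_{k≥1} be i.i.d. with P(X_k = +1) = q and P(X_k = −1) = p = 1 − q, where 0 < q < 1/2 (so q < p), let S_0 = 0, S_i = X_1 + ⋯ + X_i, and let ν = inf{i ≥ 1 : S_i = −1}. Then for every integer n ≥ 0, E[ Σ_{i=1}^{ν} 1_{(S_i < n) ∧ (S_i < S_{i−1})} ] = (p/(p − q)) (1 − (q/p)^{n+1}). -/

import Mathlib

open MeasureTheory ProbabilityTheory Filter Finset

/-- Partial sums of the walk: `walkS X n ω = X 1 ω + ⋯ + X n ω` (so `walkS X 0 ω = 0`). -/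
noncomputable def walkS {Ω : Type*} (X : ℕ → Ω → ℤ) (n : ℕ) (ω : Ω) : ℤ :=
  ∑ i ∈ Finset.Icc 1 n, X i ω

/-- First hitting time of `-1` by the walk (`sInf ∅ = 0` by convention). -/
noncomputable def hitMinusOne {Ω : Type*} (X : ℕ → Ω → ℤ) (ω : Ω) : ℕ :=
  sInf {n : ℕ | 1 ≤ n ∧ walkS X n ω = -1}

open scoped ENNReal

open Classical in
/-- `f (S_k)` restricted to the event that the walk stays nonnegative up to time `k`. -/
noncomputable def aliveG {Ω : Type*} (X : ℕ → Ω → ℤ) (k : ℕ) (f : ℤ → ℝ≥0∞) (ω : Ω) : ℝ≥0∞ :=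
  if ∀ j ≤ k, 0 ≤ walkS X j ω then f (walkS X k ω) else 0

lemma walkS_succ' {Ω : Type*} (X : ℕ → Ω → ℤ) (k : ℕ) (ω : Ω) :
    walkS X (k + 1) ω = walkS X k ω + X (k + 1) ω := by
  unfold walkS
  rw [Finset.sum_Icc_succ_top (by omega)]

lemma walkS_zero' {Ω : Type*} (X : ℕ → Ω → ℤ) (ω : Ω) : walkS X 0 ω = 0 := by
  simp [walkS]

lemma aliveG_factor {Ω : Type*} (X : ℕ → Ω → ℤ) (k : ℕ) (f : ℤ → ℝ≥0∞) :
    ∃ φ : ((Finset.Icc 1 k) → ℤ) → ℝ≥0∞,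
      aliveG X k f = φ ∘ (fun ω (i : Finset.Icc 1 k) => X i ω) := by
  classical
  let e : ℕ → ((Finset.Icc 1 k) → ℤ) → ℤ := fun i t => if h : i ∈ Finset.Icc 1 k then t ⟨i, h⟩ else 0
  refine ⟨aliveG e k f, ?_⟩
  funext ω
  have h : ∀ j ≤ k, walkS e j (fun (i : Finset.Icc 1 k) => X i ω) = walkS X j ω := by
    intro j hj
    unfold walkS
    refine Finset.sum_congr rfl fun i hi => ?_
    have : i ∈ Finset.Icc 1 k := by
      simp only [Finset.mem_Icc] at hi ⊢; omega
    simp only [e, dif_pos this]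
  simp only [aliveG, Function.comp]
  rw [h k le_rfl]
  congr 1
  apply propext
  exact forall₂_congr fun j hj => by rw [h j hj]

lemma aliveG_meas {Ω : Type*} [MeasurableSpace Ω] (X : ℕ → Ω → ℤ) (hmeas : ∀ i, Measurable (X i))
    (k : ℕ) (f : ℤ → ℝ≥0∞) : Measurable (aliveG X k f) := by
  obtain ⟨φ, hφ⟩ := aliveG_factor X k f
  rw [hφ]
  exact (Measurable.of_discrete (f := φ)).comp (measurable_pi_lambda _ fun i => hmeas i)

lemma aliveG_indep {Ω : Type*} [MeasureSpace Ω]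
    (X : ℕ → Ω → ℤ) (hmeas : ∀ i, Measurable (X i))
    (hindep : iIndepFun X ℙ) (k : ℕ) (f : ℤ → ℝ≥0∞) (c : ℤ) :
    ∫⁻ ω, aliveG X k f ω * (if X (k+1) ω = c then 1 else 0) ∂(ℙ : Measure Ω)
      = (∫⁻ ω, aliveG X k f ω ∂(ℙ : Measure Ω)) * ℙ {ω | X (k+1) ω = c} := by
  obtain ⟨φ, hφ⟩ := aliveG_factor X k f
  have hi := hindep.indepFun_finset (Finset.Icc 1 k) {k+1} (by simp) hmeas
  have hi2 := hi.comp (φ := φ) (ψ := fun t => if t ⟨k+1, by simp⟩ = c then (1:ℝ≥0∞) else 0)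
    Measurable.of_discrete Measurable.of_discrete
  have hm2 : MeasurableSet {ω | X (k+1) ω = c} := hmeas (k+1) (measurableSet_singleton c)
  have hmm : Measurable (fun ω => if X (k+1) ω = c then (1:ℝ≥0∞) else 0) :=
    Measurable.ite hm2 measurable_const measurable_const
  rw [← hφ] at hi2
  have := lintegral_mul_eq_lintegral_mul_lintegral_of_indepFun (aliveG_meas X hmeas k f) hmm hi2
  simp only [Pi.mul_apply] at this
  rw [this]
  congr 1
  rw [← lintegral_indicator_one hm2]
  refine lintegral_congr fun ω => ?_
  simp [Set.indicator]

lemma aliveG_shift {Ω : Type*} (X : ℕ → Ω → ℤ) (k : ℕ) (f : ℤ → ℝ≥0∞) (hf : ∀ x < 0, f x = 0)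
    (ω : Ω) (hX : X (k+1) ω = 1 ∨ X (k+1) ω = -1) :
    aliveG X (k+1) f ω = aliveG X k (fun x => f (x+1)) ω * (if X (k+1) ω = 1 then 1 else 0)
      + aliveG X k (fun x => f (x-1)) ω * (if X (k+1) ω = -1 then 1 else 0) := by
  have h1 : aliveG X (k+1) f ω = aliveG X k (fun x => f (x + X (k+1) ω)) ω := by
    unfold aliveG
    by_cases hB : ∀ j ≤ k, 0 ≤ walkS X j ω
    · rw [if_pos hB, walkS_succ']
      split_ifs with h
      · rfl
      · show 0 = f _
        rw [hf]
        by_contra hc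
        apply h
        intro j hj
        rcases Nat.lt_or_ge k j with h2 | h2
        · obtain rfl : j = k + 1 := by omega
          rw [walkS_succ']; omega
        · exact hB j h2
    · rw [if_neg hB, if_neg]
      intro h
      exact hB fun j hj => h j (by omega)
  rw [h1]
  rcases hX with h | h <;> simp [h, sub_eq_add_neg]

lemma steps_ae {Ω : Type*} [MeasureSpace Ω] [IsProbabilityMeasure (ℙ : Measure Ω)]
    (q p : ℝ) (hq : 0 < q) (hq1 : q < 1 / 2) (hp : p = 1 - q)
    (X : ℕ → Ω → ℤ) (hmeas : ∀ i, Measurable (X i))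
    (hup : ∀ i, ℙ {ω | X i ω = 1} = ENNReal.ofReal q)
    (hdown : ∀ i, ℙ {ω | X i ω = -1} = ENNReal.ofReal p) :
    ∀ᵐ ω ∂(ℙ : Measure Ω), ∀ i, X i ω = 1 ∨ X i ω = -1 := by
  rw [ae_all_iff]
  intro i
  have hm1 : MeasurableSet {ω | X i ω = 1} := hmeas i (measurableSet_singleton 1)
  have hm2 : MeasurableSet {ω | X i ω = -1} := hmeas i (measurableSet_singleton (-1))
  have hd : Disjoint {ω | X i ω = 1} {ω | X i ω = -1} := by
    rw [Set.disjoint_left]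
    intro ω h1 h2
    simp only [Set.mem_ofPred_eq] at h1 h2
    omega
  have hu : ℙ ({ω | X i ω = 1} ∪ {ω | X i ω = -1}) = 1 := by
    rw [measure_union hd hm2, hup, hdown, ← ENNReal.ofReal_add hq.le (by linarith), hp]
    simp
  exact (prob_compl_eq_zero_iff (hm1.union hm2)).2 hu

lemma aliveG_rec {Ω : Type*} [MeasureSpace Ω] [IsProbabilityMeasure (ℙ : Measure Ω)]
    (q p : ℝ) (hq : 0 < q) (hq1 : q < 1 / 2) (hp : p = 1 - q)
    (X : ℕ → Ω → ℤ) (hmeas : ∀ i, Measurable (X i))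
    (hindep : iIndepFun X ℙ)
    (hup : ∀ i, ℙ {ω | X i ω = 1} = ENNReal.ofReal q)
    (hdown : ∀ i, ℙ {ω | X i ω = -1} = ENNReal.ofReal p)
    (h g : ℤ → ℝ) (hneg : ∀ x < 0, h x = 0) (hpos : ∀ x, 0 ≤ h x) (gpos : ∀ x, 0 ≤ g x)
    (heq : ∀ x, 0 ≤ x → h x = g x + q * h (x+1) + p * h (x-1)) (k : ℕ) :
    ENNReal.ofReal (h 0) = ∑ i ∈ Finset.range k,
        ∫⁻ ω, aliveG X i (fun x => ENNReal.ofReal (g x)) ω ∂(ℙ : Measure Ω)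
      + ∫⁻ ω, aliveG X k (fun x => ENNReal.ofReal (h x)) ω ∂(ℙ : Measure Ω) := by
  have hp0 : 0 < p := by linarith
  induction k with
  | zero => simp [aliveG, walkS_zero']
  | succ k ih =>
    rw [ih, Finset.sum_range_succ, add_assoc]
    congr 1
    have e1 : ∫⁻ ω, aliveG X (k+1) (fun x => ENNReal.ofReal (h x)) ω ∂(ℙ : Measure Ω)
        = (∫⁻ ω, aliveG X k (fun x => ENNReal.ofReal (h (x+1))) ω ∂(ℙ : Measure Ω)) * ENNReal.ofReal q
        + (∫⁻ ω, aliveG X k (fun x => ENNReal.ofReal (h (x-1))) ω ∂(ℙ : Measure Ω)) * ENNReal.ofReal p := by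
      rw [← hup (k+1), ← hdown (k+1), ← aliveG_indep X hmeas hindep, ← aliveG_indep X hmeas hindep,
        ← lintegral_add_left]
      · apply lintegral_congr_ae
        filter_upwards [steps_ae q p hq hq1 hp X hmeas hup hdown] with ω hω
        exact aliveG_shift X k (fun x => ENNReal.ofReal (h x))
          (fun x hx => by simp [hneg x hx]) ω (hω (k+1))
      · exact (aliveG_meas X hmeas k _).mul
          (Measurable.ite (hmeas (k+1) (measurableSet_singleton 1)) measurable_const measurable_const)
    rw [e1, ← lintegral_mul_const _ (aliveG_meas X hmeas k _),
      ← lintegral_mul_const _ (aliveG_meas X hmeas k _),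
      ← lintegral_add_left ((aliveG_meas X hmeas k _).mul_const _),
      ← lintegral_add_left (aliveG_meas X hmeas k _)]
    refine lintegral_congr fun ω => ?_
    unfold aliveG
    split_ifs with hB
    · beta_reduce
      rw [heq _ (hB k le_rfl), ← ENNReal.ofReal_mul (hpos _), ← ENNReal.ofReal_mul (hpos _),
        ← ENNReal.ofReal_add (mul_nonneg (hpos _) hq.le) (mul_nonneg (hpos _) hp0.le),
        ← ENNReal.ofReal_add (gpos _) (add_nonneg (mul_nonneg (hpos _) hq.le) (mul_nonneg (hpos _) hp0.le))]
      congr 1; ring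
    · simp

/-- the increments of the potential -/
noncomputable def potD (q p : ℝ) (n : ℕ) (y : ℕ) : ℝ := (1 - (q / p) ^ (n + 1 - y)) / (p - q)

/-- the potential -/
noncomputable def potH (q p : ℝ) (n : ℕ) (x : ℤ) : ℝ :=
  ∑ y ∈ Finset.range (x + 1).toNat, potD q p n y

lemma potD_nonneg (q p : ℝ) (hq : 0 < q) (hqp : q < p) (n y : ℕ) : 0 ≤ potD q p n y := by
  unfold potD
  have h1 : (q / p) ^ (n + 1 - y) ≤ 1 :=
    pow_le_one₀ (by have := hq.trans hqp; positivity) ((div_le_one (hq.trans hqp)).2 hqp.le)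
  exact div_nonneg (by linarith) (by linarith)

lemma potD_eq (q p : ℝ) (hq : 0 < q) (hqp : q < p) (n y : ℕ) :
    p * potD q p n y - q * potD q p n (y+1) = if y ≤ n then 1 else 0 := by
  unfold potD
  have hp0 : p ≠ 0 := (hq.trans hqp).ne'
  have hd : p - q ≠ 0 := by linarith
  split_ifs with h
  · obtain ⟨m, rfl⟩ := Nat.exists_eq_add_of_le h
    rw [show y + m + 1 - y = m + 1 by omega, show y + m + 1 - (y+1) = m by omega, pow_succ]
    field_simp
    ring
  · rw [show n + 1 - y = 0 by omega, show n + 1 - (y+1) = 0 by omega]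
    simp

lemma potH_eq (q p : ℝ) (hq : 0 < q) (hqp : q < p) (hp : p = 1 - q) (n : ℕ) (x : ℤ) (hx : 0 ≤ x) :
    potH q p n x = (if x ≤ n then 1 else 0) + q * potH q p n (x+1) + p * potH q p n (x-1) := by
  obtain ⟨m, rfl⟩ := Int.eq_ofNat_of_zero_le hx
  unfold potH
  rw [show ((m:ℤ) + 1).toNat = m + 1 by omega, show ((m:ℤ) + 1 + 1).toNat = m + 1 + 1 by omega,
    show ((m:ℤ) - 1 + 1).toNat = m by omega, Finset.sum_range_succ _ (m+1), Finset.sum_range_succ _ m]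
  have := potD_eq q p hq hqp n m
  simp only [Nat.cast_le]
  rw [← this, hp]
  ring

lemma potH_le (q p : ℝ) (hq : 0 < q) (hqp : q < p) (n : ℕ) (x : ℤ) :
    potH q p n x ≤ ∑ y ∈ Finset.range (n+1), potD q p n y := by
  unfold potH
  rcases le_total (x + 1).toNat (n + 1) with h | h
  · exact Finset.sum_le_sum_of_subset_of_nonneg (Finset.range_mono h)
      fun y _ _ => potD_nonneg q p hq hqp n y
  · refine (Finset.sum_subset (Finset.range_mono h) fun y _ hy => ?_).ge
    simp only [Finset.mem_range] at hy
    simp [potD, show n + 1 - y = 0 by omega]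

lemma path_sum {Ω : Type*} (X : ℕ → Ω → ℤ) (n : ℕ) (ω : Ω)
    (hX : ∀ i, X i ω = 1 ∨ X i ω = -1) (hex : ∃ k, ¬ ∀ j ≤ k, 0 ≤ walkS X j ω) :
    ENNReal.ofReal (∑ i ∈ Finset.Icc 1 (hitMinusOne X ω),
        if walkS X i ω < n ∧ walkS X i ω < walkS X (i - 1) ω then (1 : ℝ) else 0)
      = ∑' i, aliveG X i (fun x => ENNReal.ofReal (if x ≤ n then 1 else 0)) ω
          * (if X (i+1) ω = -1 then 1 else 0) := by
  classical
  have hex' : ∃ m, walkS X m ω < 0 := by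
    obtain ⟨k, hk⟩ := hex
    push Not at hk
    obtain ⟨j, _, hj⟩ := hk
    exact ⟨j, hj⟩
  obtain ⟨m, hm, hmin⟩ : ∃ m, walkS X m ω < 0 ∧ ∀ j < m, 0 ≤ walkS X j ω :=
    ⟨Nat.find hex', Nat.find_spec hex', fun j hj => not_lt.1 (Nat.find_min hex' hj)⟩
  have hm0 : m ≠ 0 := by
    rintro rfl
    rw [walkS_zero'] at hm; omega
  obtain ⟨l, rfl⟩ := Nat.exists_eq_succ_of_ne_zero hm0
  have hS : walkS X (l+1) ω = -1 := by
    have h1 := hmin l (by omega)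
    have h2 := hX (l+1)
    simp only [Nat.succ_eq_add_one] at hm
    rw [walkS_succ'] at hm ⊢
    omega
  have hhit : hitMinusOne X ω = l + 1 := by
    unfold hitMinusOne
    apply le_antisymm
    · exact Nat.sInf_le ⟨by omega, hS⟩
    · have hne : {n : ℕ | 1 ≤ n ∧ walkS X n ω = -1}.Nonempty := ⟨l + 1, by omega, hS⟩
      refine le_csInf hne ?_
      rintro j ⟨_, hj⟩
      by_contra hc
      have := hmin j (by omega)
      omega
  rw [hhit, tsum_eq_sum (s := Finset.range (l+1)), ENNReal.ofReal_sum_of_nonneg]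
  · rw [show Finset.Icc 1 (l+1) = (Finset.range (l+1)).map ⟨fun i => i + 1, add_left_injective 1⟩ by
      ext i
      simp only [Finset.mem_Icc, Finset.mem_map, Finset.mem_range, Function.Embedding.coeFn_mk]
      constructor
      · intro h
        exact ⟨i - 1, by omega, by omega⟩
      · rintro ⟨j, hj, rfl⟩
        omega, Finset.sum_map]
    refine Finset.sum_congr rfl fun i hi => ?_
    simp only [Finset.mem_range] at hi
    have hB : ∀ j ≤ i, 0 ≤ walkS X j ω := fun j hj => hmin j (by omega)
    simp only [Function.Embedding.coeFn_mk, Nat.add_sub_cancel, aliveG, if_pos hB, walkS_succ']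
    rcases hX (i+1) with h | h
    · simp [h]
    · have : (walkS X i ω + -1 < n) ↔ walkS X i ω ≤ n := by omega
      simp [h, this]
  · intro i _
    split_ifs <;> norm_num
  · intro i hi
    have : ¬ ∀ j ≤ i, 0 ≤ walkS X j ω := by
      intro h
      have := h (l+1) (by simpa using hi)
      omega
    simp [aliveG, this]

theorem stmt9 {Ω : Type*} [MeasureSpace Ω] [IsProbabilityMeasure (ℙ : Measure Ω)]
    (q p : ℝ) (hq : 0 < q) (hq1 : q < 1 / 2) (hp : p = 1 - q)
    (X : ℕ → Ω → ℤ) (hmeas : ∀ i, Measurable (X i))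
    (hindep : iIndepFun X ℙ)
    (hup : ∀ i, ℙ {ω | X i ω = 1} = ENNReal.ofReal q)
    (hdown : ∀ i, ℙ {ω | X i ω = -1} = ENNReal.ofReal p)
    (n : ℕ) :
    ∫ ω, (∑ i ∈ Finset.Icc 1 (hitMinusOne X ω),
        if walkS X i ω < n ∧ walkS X i ω < walkS X (i - 1) ω then (1 : ℝ) else 0)
        ∂(ℙ : Measure Ω)
      = p / (p - q) * (1 - (q / p) ^ (n + 1)) := by
  have hqp : q < p := by linarith
  have hp0 : 0 < p := by linarith
  have hd : 0 < p - q := by linarith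
  -- survival probabilities are summable
  have hsum : ∑' i, ∫⁻ ω, aliveG X i (fun _ => ENNReal.ofReal 1) ω ∂(ℙ : Measure Ω) ≠ ∞ := by
    have hle : ∑' i, ∫⁻ ω, aliveG X i (fun _ => ENNReal.ofReal 1) ω ∂(ℙ : Measure Ω)
        ≤ ENNReal.ofReal ((if (0:ℤ) < 0 then 0 else ((0:ℤ) + 1 : ℝ)) / (p - q)) := by
      rw [ENNReal.tsum_eq_iSup_nat]
      refine iSup_le fun k => ?_
      have := aliveG_rec q p hq hq1 hp X hmeas hindep hup hdown
        (fun x => (if x < 0 then 0 else (x + 1 : ℝ)) / (p - q)) (fun _ => 1)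
        (fun x hx => by simp [hx])
        (fun x => by
          apply div_nonneg _ hd.le
          split_ifs with h
          · exact le_rfl
          · have : (0:ℝ) ≤ x := by exact_mod_cast not_lt.1 h
            linarith)
        (fun _ => zero_le_one)
        (fun x hx => by
          rw [if_neg (by omega), if_neg (by omega)]
          by_cases h0 : x = 0
          · subst h0
            simp
            field_simp
            rw [hp]; ring
          · rw [if_neg (by omega)]
            push_cast
            field_simp
            rw [hp]; ring) k
      rw [this]
      exact le_self_add
    exact ne_top_of_le_ne_top ENNReal.ofReal_ne_top hle
  have hlim := ENNReal.tendsto_atTop_zero_of_tsum_ne_top hsum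
  -- the walk becomes negative almost surely
  have hneg : ∀ᵐ ω ∂(ℙ : Measure Ω), ∃ k, ¬ ∀ j ≤ k, 0 ≤ walkS X j ω := by
    have hz : ∫⁻ ω, ∑' i, aliveG X i (fun _ => ENNReal.ofReal 1) ω ∂(ℙ : Measure Ω) ≠ ∞ := by
      rwa [lintegral_tsum fun i => (aliveG_meas X hmeas i _).aemeasurable]
    have := ae_lt_top (Measurable.ennreal_tsum fun i => aliveG_meas X hmeas i _) hz
    filter_upwards [this] with ω hω
    by_contra hc
    push Not at hc
    have h1 : ∀ i, aliveG X i (fun _ => ENNReal.ofReal 1) ω = 1 := by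
      intro i
      unfold aliveG
      rw [if_pos (hc i)]; simp
    simp_rw [h1] at hω
    simp at hω
  set g : ℤ → ℝ := fun x => if x ≤ n then 1 else 0 with hg
  have hpotpos : ∀ x, 0 ≤ potH q p n x := fun x => Finset.sum_nonneg fun y _ => potD_nonneg q p hq hqp n y
  have hrec := aliveG_rec q p hq hq1 hp X hmeas hindep hup hdown (potH q p n) g
    (fun x hx => by simp [potH, show (x+1).toNat = 0 by omega]) hpotpos
    (fun x => by simp only [hg]; split_ifs <;> norm_num)
    (potH_eq q p hq hqp hp n)
  set C : ℝ := ∑ y ∈ Finset.range (n+1), potD q p n y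
  have hrem : Tendsto (fun k => ∫⁻ ω, aliveG X k (fun x => ENNReal.ofReal (potH q p n x)) ω ∂(ℙ : Measure Ω))
      atTop (nhds 0) := by
    have h0 : Tendsto (fun k => ENNReal.ofReal C *
        ∫⁻ ω, aliveG X k (fun _ => ENNReal.ofReal 1) ω ∂(ℙ : Measure Ω)) atTop (nhds 0) := by
      simpa using ENNReal.Tendsto.const_mul hlim (Or.inr ENNReal.ofReal_ne_top)
    refine tendsto_of_tendsto_of_tendsto_of_le_of_le tendsto_const_nhds h0 (fun _ => zero_le) fun k => ?_
    simp only
    rw [← lintegral_const_mul _ (aliveG_meas X hmeas k _)]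
    refine lintegral_mono fun ω => ?_
    unfold aliveG
    split_ifs
    · simpa using ENNReal.ofReal_le_ofReal (potH_le q p hq hqp n _)
    · simp
  have htot : ∑' i, ∫⁻ ω, aliveG X i (fun x => ENNReal.ofReal (g x)) ω ∂(ℙ : Measure Ω)
      = ENNReal.ofReal (potH q p n 0) := by
    have h1 := (ENNReal.tendsto_nat_tsum
      (fun i => ∫⁻ ω, aliveG X i (fun x => ENNReal.ofReal (g x)) ω ∂(ℙ : Measure Ω))).add hrem
    have h2 := h1.congr (fun k => (hrec k).symm)
    have h3 := tendsto_nhds_unique h2 tendsto_const_nhds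
    simpa using h3
  -- the integrand
  have hae : (fun ω => ENNReal.ofReal (∑ i ∈ Finset.Icc 1 (hitMinusOne X ω),
        if walkS X i ω < n ∧ walkS X i ω < walkS X (i - 1) ω then (1 : ℝ) else 0))
      =ᵐ[(ℙ : Measure Ω)] fun ω => ∑' i, aliveG X i (fun x => ENNReal.ofReal (g x)) ω
          * (if X (i+1) ω = -1 then 1 else 0) := by
    filter_upwards [hneg, steps_ae q p hq hq1 hp X hmeas hup hdown] with ω h1 h2
    exact path_sum X n ω h2 h1
  have hmi : ∀ i, Measurable (fun ω => aliveG X i (fun x => ENNReal.ofReal (g x)) ω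
          * (if X (i+1) ω = -1 then 1 else 0)) := fun i =>
    (aliveG_meas X hmeas i _).mul
      (Measurable.ite (hmeas (i+1) (measurableSet_singleton (-1))) measurable_const measurable_const)
  have hnn : ∀ ω, 0 ≤ ∑ i ∈ Finset.Icc 1 (hitMinusOne X ω),
        if walkS X i ω < n ∧ walkS X i ω < walkS X (i - 1) ω then (1 : ℝ) else 0 := fun ω =>
    Finset.sum_nonneg fun i _ => by split_ifs <;> norm_num
  rw [integral_eq_lintegral_of_nonneg_ae (Eventually.of_forall hnn), lintegral_congr_ae hae,
    lintegral_tsum fun i => (hmi i).aemeasurable]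
  · simp_rw [aliveG_indep X hmeas hindep, hdown]
    rw [ENNReal.tsum_mul_right, htot, ← ENNReal.ofReal_mul (hpotpos 0),
      ENNReal.toReal_ofReal (mul_nonneg (hpotpos 0) hp0.le)]
    simp [potH, potD]
    ring
  · have hmeasR : AEMeasurable (fun ω => (ENNReal.ofReal (∑ i ∈ Finset.Icc 1 (hitMinusOne X ω),
        if walkS X i ω < n ∧ walkS X i ω < walkS X (i - 1) ω then (1 : ℝ) else 0)).toReal)
        (ℙ : Measure Ω) :=
      (AEMeasurable.congr (Measurable.ennreal_tsum hmi).aemeasurable hae.symm).ennreal_toReal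
    refine (hmeasR.congr (Eventually.of_forall fun ω => ?_)).aestronglyMeasurable
    exact ENNReal.toReal_ofReal (hnn ω)
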